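/- Let ⟨f0, f1⟩ be an MWG-drawing of a pair ⟨G0, G1⟩ of finite simple graphs such that each G_i has diameter at most 2, i.e. any two distinct vertices of G_i are adjacent or have a common neighbor. Then no segment of the first drawing meets a segment of the second: for all vertices u, v of G0 and all vertices u', v' of G1, the closed segments [f0(u), f0(v)] and [f1(u'), f1(v')] are disjoint. -/

import Mathlib

noncomputable section

/-- The Euclidean plane. -/
abbrev Pt : Type := EuclideanSpace ℝ (Fin 2)

/-- The Gabriel disk `D[u,v]`: the closed disk having `u` and `v` as antipodal points. -/
def gabrielDisk (u v : Pt) : Set Pt := Metric.closedBall (midpoint ℝ u v) (dist u v / 2)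

/-- `f` is a witness Gabriel drawing of the finite simple graph `G` with witness set `P`. -/
def IsWGDrawing {V : Type*} [Fintype V] (G : SimpleGraph V) (f : V → Pt) (P : Set Pt) : Prop :=
  Function.Injective f ∧ Disjoint (Set.range f) P ∧
    ∀ u v : V, u ≠ v → (G.Adj u v ↔ gabrielDisk (f u) (f v) ∩ P = ∅)

/-- `⟨f₀, f₁⟩` is a mutual witness Gabriel drawing of the pair `⟨G₀, G₁⟩`. -/
def IsMWGDrawing {V₀ V₁ : Type*} [Fintype V₀] [Fintype V₁]
    (G₀ : SimpleGraph V₀) (G₁ : SimpleGraph V₁) (f₀ : V₀ → Pt) (f₁ : V₁ → Pt) : Prop :=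
  Function.Injective f₀ ∧ Function.Injective f₁ ∧
    Disjoint (Set.range f₀) (Set.range f₁) ∧
    (∀ u v : V₀, u ≠ v → (G₀.Adj u v ↔ gabrielDisk (f₀ u) (f₀ v) ∩ Set.range f₁ = ∅)) ∧
    (∀ u v : V₁, u ≠ v → (G₁.Adj u v ↔ gabrielDisk (f₁ u) (f₁ v) ∩ Set.range f₀ = ∅))

/-- Two subsets of the plane are linearly separable. -/
def LinSep (A B : Set Pt) : Prop :=
  ∃ (φ : Pt →ₗ[ℝ] ℝ) (c : ℝ), φ ≠ 0 ∧ (∀ a ∈ A, φ a < c) ∧ ∀ b ∈ B, c < φ b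

open scoped InnerProductSpace

theorem mem_gabrielDisk_iff {u v z : Pt} : z ∈ gabrielDisk u v ↔ ⟪u - z, v - z⟫_ℝ ≤ 0 := by
  have hmid : dist z (midpoint ℝ u v) = ‖(u - z) + (v - z)‖ / 2 := by
    have h : midpoint ℝ u v - z = (2⁻¹ : ℝ) • ((u - z) + (v - z)) := by
      rw [midpoint_eq_smul_add, invOf_eq_inv]
      module
    rw [dist_comm, dist_eq_norm, h, norm_smul]
    norm_num
    ring
  have hdist : dist u v = ‖(u - z) - (v - z)‖ := by
    rw [dist_eq_norm, sub_sub_sub_cancel_right]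
  rw [gabrielDisk, Metric.mem_closedBall, hmid, hdist,
    div_le_div_iff_of_pos_right two_pos, ← sq_le_sq₀ (norm_nonneg _) (norm_nonneg _),
    norm_add_sq_real (u - z), norm_sub_sq_real (u - z)]
  constructor <;> intro h <;> linarith

/-- No point of `Q` sees `a` and `b` at an angle of at least `π / 2`. -/
def AcuteFrom (Q : Set Pt) (a b : Pt) : Prop :=
  ∀ z ∈ Q, 0 < ⟪a - z, b - z⟫_ℝ

theorem AcuteFrom.self {Q : Set Pt} {a : Pt} (ha : a ∉ Q) : AcuteFrom Q a a := by
  intro z hz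
  rw [real_inner_self_eq_norm_sq]
  have : a - z ≠ 0 := sub_ne_zero.mpr fun h => ha (h ▸ hz)
  positivity

/-- If `p` and `q` both form acute pairs with `r`, the triangle `pqr` contains no witness. -/
theorem AcuteFrom.notMem_convexHull {Q : Set Pt} {p q r z : Pt} (hr : r ∉ Q)
    (hp : AcuteFrom Q p r) (hq : AcuteFrom Q q r) (hz : z ∈ Q) :
    z ∉ convexHull ℝ {p, q, r} := by
  intro hmem
  have hconv : Convex ℝ {y : Pt | ⟪r - z, z⟫_ℝ < ⟪r - z, y⟫_ℝ} :=
    convex_halfSpace_gt (innerₛₗ ℝ (r - z)).isLinear _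
  have hpos : ∀ y, AcuteFrom Q y r → ⟪r - z, z⟫_ℝ < ⟪r - z, y⟫_ℝ := fun y hy => by
    have h := hy z hz
    rw [real_inner_comm, inner_sub_right] at h
    linarith
  have hsub : ({p, q, r} : Set Pt) ⊆ {y : Pt | ⟪r - z, z⟫_ℝ < ⟪r - z, y⟫_ℝ} := by
    rintro y (rfl | rfl | rfl)
    · exact hpos _ hp
    · exact hpos _ hq
    · exact hpos _ (AcuteFrom.self hr)
  exact lt_irrefl ⟪r - z, z⟫_ℝ (convexHull_min hsub hconv hmem)

/-- Two segments whose endpoints pairwise see each other at acute angles are disjoint. -/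
theorem disjoint_segment_of_inner_pos {a b p q : Pt}
    (hp : 0 < ⟪a - p, b - p⟫_ℝ) (hq : 0 < ⟪a - q, b - q⟫_ℝ)
    (ha : 0 < ⟪p - a, q - a⟫_ℝ) (hb : 0 < ⟪p - b, q - b⟫_ℝ) :
    Disjoint (segment ℝ a b) (segment ℝ p q) := by
  rw [Set.disjoint_left]
  rintro x ⟨s, t, hs, ht, hst, hx⟩ ⟨m, n, hm, hn, hmn, hx'⟩
  have h0 := congrArg (fun y : Pt => y 0) (hx.trans hx'.symm)
  have h1 := congrArg (fun y : Pt => y 1) (hx.trans hx'.symm)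
  simp only [PiLp.inner_apply, Fin.sum_univ_two, PiLp.sub_apply, PiLp.add_apply, PiLp.smul_apply,
    smul_eq_mul, RCLike.inner_apply, conj_trivial] at *
  have hpos : ∀ {α β A B : ℝ}, 0 ≤ α → 0 ≤ β → α + β = 1 → 0 < A → 0 < B →
      0 < α * A + β * B := by
    intro α β A B hα hβ hαβ hA hB
    rcases hα.eq_or_lt with h | h
    · have : β = 1 := by linarith
      subst h this
      simpa
    · positivity
  have h2 := hpos hm hn hmn hp hq
  have h3 := hpos hs ht hst ha hb
  obtain rfl : t = 1 - s := by linarith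
  obtain rfl : n = 1 - m := by linarith
  have key : ∀ {A B P Q : ℝ}, s * A + (1 - s) * B = m * P + (1 - m) * Q →
      m * ((B - P) * (A - P)) + (1 - m) * ((B - Q) * (A - Q)) +
        (s * ((Q - A) * (P - A)) + (1 - s) * ((Q - B) * (P - B))) = 0 := by
    intro A B P Q h
    linear_combination (A + B - P - Q) * h
  linarith [key h0, key h1]

theorem exists_mem_segment_eq_zero (f : Pt →ᵃ[ℝ] ℝ) {p q : Pt} (h : f p * f q ≤ 0) :
    ∃ y ∈ segment ℝ p q, f y = 0 := by
  have h0 : (0 : ℝ) ∈ segment ℝ (f p) (f q) := by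
    rw [segment_eq_uIcc, Set.mem_uIcc]
    exact (mul_nonpos_iff.mp h).symm.imp_right And.symm
  rw [← image_segment ℝ f] at h0
  exact h0

/-- A segment meeting one side of a triangle ends in the triangle or meets another side. -/
theorem segment_meets_side {a b p q r x : Pt} (hab : x ∈ segment ℝ a b)
    (hpq : x ∈ segment ℝ p q) :
    a ∈ convexHull ℝ {p, q, r} ∨ b ∈ convexHull ℝ {p, q, r} ∨
      ∃ y ∈ segment ℝ a b, y ∈ segment ℝ p r ∨ y ∈ segment ℝ q r := by
  have hsub : ∀ {u v : Pt}, u ∈ ({p, q, r} : Set Pt) → v ∈ ({p, q, r} : Set Pt) →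
      segment ℝ u v ⊆ convexHull ℝ {p, q, r} := fun hu hv =>
    segment_subset_convexHull hu hv
  have hxT : x ∈ convexHull ℝ {p, q, r} := hsub (by simp) (by simp) hpq
  rcases eq_or_ne a b with rfl | hne
  · rw [segment_same, Set.mem_singleton_iff] at hab
    exact Or.inl (hab ▸ hxT)
  obtain ⟨f, hf⟩ : ∃ f : Pt →ᵃ[ℝ] ℝ, ∀ z,
      f z = (b 0 - a 0) * (z 1 - a 1) - (b 1 - a 1) * (z 0 - a 0) := by
    let g : Pt →ₗ[ℝ] ℝ :=
      (b 0 - a 0) • (EuclideanSpace.proj 1 : Pt →L[ℝ] ℝ).toLinearMap -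
        (b 1 - a 1) • (EuclideanSpace.proj 0 : Pt →L[ℝ] ℝ).toLinearMap
    refine ⟨g.toAffineMap - AffineMap.const ℝ Pt (g a), fun z => ?_⟩
    simp [g]
    ring
  have hline : ∀ y, f y = 0 → ∃ t : ℝ, y = AffineMap.lineMap a b t := by
    intro y hy
    rw [hf] at hy
    have hpos : (b 0 - a 0) ^ 2 + (b 1 - a 1) ^ 2 ≠ 0 := by
      intro h
      apply hne
      ext i
      fin_cases i <;> simp <;> nlinarith [sq_nonneg (b 0 - a 0), sq_nonneg (b 1 - a 1)]
    refine ⟨((y 0 - a 0) * (b 0 - a 0) + (y 1 - a 1) * (b 1 - a 1)) /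
      ((b 0 - a 0) ^ 2 + (b 1 - a 1) ^ 2), ?_⟩
    ext i
    fin_cases i <;> simp [AffineMap.lineMap_apply] <;> field_simp
    · linear_combination -(b 1 - a 1) * hy
    · linear_combination (b 0 - a 0) * hy
  have hfx : f x = 0 := by
    have h : f x ∈ segment ℝ (f a) (f b) := image_segment ℝ f a b ▸ Set.mem_image_of_mem f hab
    have ha : f a = 0 := by rw [hf]; ring
    have hb : f b = 0 := by rw [hf]; ring
    simpa [ha, hb] using h
  have hfpq : f p * f q ≤ 0 := by
    have h : f x ∈ segment ℝ (f p) (f q) := image_segment ℝ f p q ▸ Set.mem_image_of_mem f hpq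
    rw [hfx, segment_eq_uIcc, Set.mem_uIcc] at h
    exact mul_nonpos_iff.mpr (h.imp_right And.symm).symm
  obtain ⟨y, hyT, hy, hfy⟩ : ∃ y ∈ convexHull ℝ {p, q, r},
      (y ∈ segment ℝ p r ∨ y ∈ segment ℝ q r) ∧ f y = 0 := by
    rcases le_or_gt (f p * f r) 0 with h | h
    · obtain ⟨y, hy, hfy⟩ := exists_mem_segment_eq_zero f h
      exact ⟨y, hsub (by simp) (by simp) hy, Or.inl hy, hfy⟩
    · have hqr : f q * f r ≤ 0 := by
        by_contra! h'
        nlinarith [mul_pos h h', mul_nonneg (neg_nonneg.mpr hfpq) (sq_nonneg (f r))]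
      obtain ⟨y, hy, hfy⟩ := exists_mem_segment_eq_zero f hqr
      exact ⟨y, hsub (by simp) (by simp) hy, Or.inr hy, hfy⟩
  obtain ⟨t, rfl⟩ := hline y hfy
  rw [segment_eq_image_lineMap] at hab
  obtain ⟨s, ⟨hs0, hs1⟩, rfl⟩ := hab
  have hbetween : ∀ k ∈ segment ℝ s t, AffineMap.lineMap a b k ∈ convexHull ℝ {p, q, r} := by
    intro k hk
    have h := Set.mem_image_of_mem (AffineMap.lineMap a b : ℝ →ᵃ[ℝ] Pt) hk
    rw [image_segment] at h
    exact (convex_convexHull ℝ _).segment_subset hxT hyT h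
  simp only [segment_eq_uIcc, Set.mem_uIcc] at hbetween
  rcases lt_or_ge t 0 with ht0 | ht0
  · exact Or.inl (by simpa using hbetween 0 (Or.inr ⟨ht0.le, hs0⟩))
  rcases lt_or_ge 1 t with ht1 | ht1
  · exact Or.inr (Or.inl (by simpa using hbetween 1 (Or.inl ⟨hs1, ht1.le⟩)))
  · refine Or.inr (Or.inr ⟨_, ?_, hy⟩)
    rw [segment_eq_image_lineMap]
    exact ⟨t, ⟨ht0, ht1⟩, rfl⟩

theorem disjoint_segment_of_hub {A : Set Pt} {a b p q r : Pt} (ha : a ∈ A) (hb : b ∈ A)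
    (hr : r ∉ A) (hp : AcuteFrom A p r) (hq : AcuteFrom A q r)
    (hpr : Disjoint (segment ℝ a b) (segment ℝ p r))
    (hqr : Disjoint (segment ℝ a b) (segment ℝ q r)) :
    Disjoint (segment ℝ a b) (segment ℝ p q) := by
  rw [Set.disjoint_left] at *
  intro x hab hpq
  rcases segment_meets_side (r := r) hab hpq with h | h | ⟨y, hy, h | h⟩
  · exact AcuteFrom.notMem_convexHull hr hp hq ha h
  · exact AcuteFrom.notMem_convexHull hr hp hq hb h
  · exact hpr hy h
  · exact hqr hy h

/-- Two disjoint point sets in which any two points have a common acute partner span disjoint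
segments. -/
theorem disjoint_segment_of_forall_hub {A B : Set Pt} (hAB : Disjoint A B)
    (hA : ∀ a ∈ A, ∀ b ∈ A, ∃ c ∈ A, AcuteFrom B a c ∧ AcuteFrom B b c)
    (hB : ∀ p ∈ B, ∀ q ∈ B, ∃ r ∈ B, AcuteFrom A p r ∧ AcuteFrom A q r)
    {a b p q : Pt} (ha : a ∈ A) (hb : b ∈ A) (hp : p ∈ B) (hq : q ∈ B) :
    Disjoint (segment ℝ a b) (segment ℝ p q) := by
  have hacute : ∀ a ∈ A, ∀ b ∈ A, AcuteFrom B a b → ∀ p ∈ B, ∀ q ∈ B,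
      Disjoint (segment ℝ a b) (segment ℝ p q) := by
    intro a ha b hb hab p hp q hq
    obtain ⟨r, hr, hpr, hqr⟩ := hB p hp q hq
    exact disjoint_segment_of_hub ha hb (Set.disjoint_right.mp hAB hr) hpr hqr
      (disjoint_segment_of_inner_pos (hab p hp) (hab r hr) (hpr a ha) (hpr b hb))
      (disjoint_segment_of_inner_pos (hab q hq) (hab r hr) (hqr a ha) (hqr b hb))
  obtain ⟨c, hc, hac, hbc⟩ := hA a ha b hb
  exact (disjoint_segment_of_hub hp hq (Set.disjoint_left.mp hAB hc) hac hbc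
    (hacute a ha c hc hac p hp q hq).symm (hacute b hb c hc hbc p hp q hq).symm).symm

theorem exists_hub_of_diameter_le_two {V : Type*} {G : SimpleGraph V} {f : V → Pt} {Q : Set Pt}
    (hQ : Disjoint (Set.range f) Q)
    (hadj : ∀ u v, u ≠ v → (G.Adj u v ↔ gabrielDisk (f u) (f v) ∩ Q = ∅))
    (hd : ∀ u v, u ≠ v → G.Adj u v ∨ ∃ w, G.Adj u w ∧ G.Adj v w) :
    ∀ a ∈ Set.range f, ∀ b ∈ Set.range f, ∃ c ∈ Set.range f, AcuteFrom Q a c ∧ AcuteFrom Q b c := by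
  have hself : ∀ u, AcuteFrom Q (f u) (f u) := fun u =>
    AcuteFrom.self (Set.disjoint_left.mp hQ ⟨u, rfl⟩)
  have hacute : ∀ u v, G.Adj u v → AcuteFrom Q (f u) (f v) := by
    intro u v huv z hz
    by_contra! h
    have hempty := (hadj u v huv.ne).mp huv
    exact Set.notMem_empty z (hempty ▸ ⟨mem_gabrielDisk_iff.mpr h, hz⟩)
  rintro _ ⟨u, rfl⟩ _ ⟨v, rfl⟩
  rcases eq_or_ne u v with rfl | huv
  · exact ⟨f u, ⟨u, rfl⟩, hself u, hself u⟩
  rcases hd u v huv with h | ⟨w, huw, hvw⟩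
  · exact ⟨f v, ⟨v, rfl⟩, hacute u v h, hself v⟩
  · exact ⟨f w, ⟨w, rfl⟩, hacute u w huw, hacute v w hvw⟩

/-- Lemma 1: in an MWG-drawing of two graphs of diameter at most 2, no segment of one
drawing intersects any segment of the other drawing. -/
theorem stmt3 {V₀ V₁ : Type*} [Fintype V₀] [Fintype V₁]
    (G₀ : SimpleGraph V₀) (G₁ : SimpleGraph V₁) (f₀ : V₀ → Pt) (f₁ : V₁ → Pt)
    (hMWG : IsMWGDrawing G₀ G₁ f₀ f₁)
    (hd₀ : ∀ u v : V₀, u ≠ v → G₀.Adj u v ∨ ∃ w : V₀, G₀.Adj u w ∧ G₀.Adj v w)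
    (hd₁ : ∀ u v : V₁, u ≠ v → G₁.Adj u v ∨ ∃ w : V₁, G₁.Adj u w ∧ G₁.Adj v w) :
    ∀ (u v : V₀) (u' v' : V₁),
      Disjoint (segment ℝ (f₀ u) (f₀ v)) (segment ℝ (f₁ u') (f₁ v')) := by
  obtain ⟨-, -, hdisj, h₀, h₁⟩ := hMWG
  intro u v u' v'
  exact disjoint_segment_of_forall_hub hdisj (exists_hub_of_diameter_le_two hdisj h₀ hd₀)
    (exists_hub_of_diameter_le_two hdisj.symm h₁ hd₁) ⟨u, rfl⟩ ⟨v, rfl⟩ ⟨u', rfl⟩ ⟨v', rfl⟩
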